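/- Let M be exponentially distributed with parameter λ > 0 and suppose 0 = m_0 < m_1 < ⋯ < m_{N−1} < m_N = ∞ is an equilibrium with N ≥ 3 bins for bias b, with bin lengths l_k = m_k − m_{k−1}. Then the bin lengths are strictly increasing: l_1 < l_2 < ⋯ < l_{N−1}, and moreover l_{k+1} < l_k + 1/λ for k = 1, …, N−2. -/

import Mathlib

open MeasureTheory Set Filter

/-- Conditional mean `E[M | M ∈ s]` of a random variable with density `f`. -/
noncomputable def condMean (f : ℝ → ℝ) (s : Set ℝ) : ℝ :=
  (∫ x in s, x * f x) / (∫ x in s, f x)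

/-- The bin (interval) of real numbers between two extended-real edges `lo` and `hi`. -/
def ebin (lo hi : EReal) : Set ℝ := {x : ℝ | lo ≤ (x : EReal) ∧ (x : EReal) < hi}

/-- Edges `m_0 = m_L < m_1 < ⋯ < m_{N−1} < m_N = +∞` of an `N`-bin quantizer with interior
edges `m : Fin (N−1) → ℝ`, for a source supported on `[m_L, ∞)`. -/
noncomputable def edgesL (mL : ℝ) (N : ℕ) (m : Fin (N - 1) → ℝ) (k : ℕ) : EReal :=
  if hk : k = 0 then (mL : EReal)
  else if h : k ≤ N - 1 then ((m ⟨k - 1, by omega⟩ : ℝ) : EReal)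
  else ⊤

/-- `m : Fin (N−1) → ℝ` is the vector of interior edges of an `N`-bin cheap-talk equilibrium
for a source with density `f` supported on `[m_L, ∞)` and bias `b`: the interior edges are
strictly increasing, lie above `m_L`, and every interior edge `m_k` satisfies the
centroid/nearest-neighbor condition
`m_k = (E[M | m_{k−1} ≤ M < m_k] + E[M | m_k ≤ M < m_{k+1}])/2 + b`. -/
def IsEqL (f : ℝ → ℝ) (mL b : ℝ) (N : ℕ) (m : Fin (N - 1) → ℝ) : Prop :=
  StrictMono m ∧ (∀ k, mL < m k) ∧ ∀ k : Fin (N - 1),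
    m k = (condMean f (ebin (edgesL mL N m k.val) (edgesL mL N m (k.val + 1)))
         + condMean f (ebin (edgesL mL N m (k.val + 1)) (edgesL mL N m (k.val + 2)))) / 2 + b

/-- The exponential density with rate `lam`: `f(x) = λ e^{−λx}` for `x ≥ 0`, `0` otherwise. -/
noncomputable def expPDF (lam : ℝ) (x : ℝ) : ℝ :=
  if 0 ≤ x then lam * Real.exp (-lam * x) else 0

/-- The `k`-th interior edge (`1 ≤ k ≤ N−1`) as a real number; `redge N m 0 = 0` matches the
left endpoint of the support of the exponential source. -/
noncomputable def redge (N : ℕ) (m : Fin (N - 1) → ℝ) (k : ℕ) : ℝ :=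
  if h : 1 ≤ k ∧ k ≤ N - 1 then m ⟨k - 1, by omega⟩ else 0

/-- `x / (e^{λx} − 1)`: the gap between `a + 1/λ` and the centroid of an exponential source
on `[a, a + x)`. -/
noncomputable def centroidGap (lam x : ℝ) : ℝ := x / (Real.exp (lam * x) - 1)

section centroidGap

variable {lam x y : ℝ}

lemma exp_mul_sub_one_pos (hlam : 0 < lam) (hx : 0 < x) : 0 < Real.exp (lam * x) - 1 :=
  sub_pos.2 (Real.one_lt_exp_iff.2 (mul_pos hlam hx))

lemma centroidGap_pos (hlam : 0 < lam) (hx : 0 < x) : 0 < centroidGap lam x :=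
  div_pos hx (exp_mul_sub_one_pos hlam hx)

lemma centroidGap_lt_inv (hlam : 0 < lam) (hx : 0 < x) : centroidGap lam x < 1 / lam := by
  rw [centroidGap, div_lt_div_iff₀ (exp_mul_sub_one_pos hlam hx) hlam]
  have := Real.add_one_lt_exp (mul_pos hlam hx).ne'
  linarith

lemma centroidGap_strictAntiOn (hlam : 0 < lam) : StrictAntiOn (centroidGap lam) (Ioi 0) := by
  intro x hx y hy hxy
  have hx' := mul_pos hlam hx
  have hy' := mul_pos hlam hy
  have h := strictConvexOn_exp.secant_strict_mono (a := 0) (mem_univ _) (mem_univ _)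
    (mem_univ _) hx'.ne' hy'.ne' (mul_lt_mul_of_pos_left hxy hlam)
  simp only [Real.exp_zero, sub_zero] at h
  rw [div_lt_div_iff₀ hx' hy'] at h
  rw [centroidGap, centroidGap,
    div_lt_div_iff₀ (exp_mul_sub_one_pos hlam hy) (exp_mul_sub_one_pos hlam hx)]
  refine lt_of_mul_lt_mul_left ?_ hlam.le
  linarith

lemma add_centroidGap_eq (hlam : 0 < lam) (hx : 0 < x) :
    x + centroidGap lam x = x / (1 - Real.exp (-(lam * x))) := by
  have h := exp_mul_sub_one_pos hlam hx
  have h' : 1 - Real.exp (-(lam * x)) = (Real.exp (lam * x) - 1) / Real.exp (lam * x) := by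
    rw [Real.exp_neg]
    field_simp
  rw [centroidGap, h']
  set E := Real.exp (lam * x)
  field_simp [h.ne']
  ring

lemma add_centroidGap_strictMonoOn (hlam : 0 < lam) :
    StrictMonoOn (fun x ↦ x + centroidGap lam x) (Ioi 0) := by
  intro x hx y hy hxy
  have hx' := mul_pos hlam hx
  have hy' := mul_pos hlam hy
  have h := strictConvexOn_exp.secant_strict_mono (a := 0) (mem_univ _) (mem_univ _)
    (mem_univ _) (neg_neg_of_pos hy').ne (neg_neg_of_pos hx').ne
    (neg_lt_neg (mul_lt_mul_of_pos_left hxy hlam))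
  simp only [Real.exp_zero, sub_zero] at h
  rw [← neg_div_neg_eq, ← neg_div_neg_eq (Real.exp (-(lam * x)) - 1), neg_neg, neg_neg,
    neg_sub, neg_sub, div_lt_div_iff₀ hy' hx'] at h
  have hpos {z : ℝ} (hz : 0 < lam * z) : 0 < 1 - Real.exp (-(lam * z)) :=
    sub_pos.2 (Real.exp_lt_one_iff.2 (neg_neg_of_pos hz))
  simp only [add_centroidGap_eq hlam hx, add_centroidGap_eq hlam hy]
  rw [div_lt_div_iff₀ (hpos hx') (hpos hy')]
  refine lt_of_mul_lt_mul_left ?_ hlam.le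
  linarith

end centroidGap

section integrals

variable {lam a c : ℝ}

lemma ebin_coe_coe (a c : ℝ) : ebin a c = Ico a c := by
  ext x
  simp [ebin]

lemma ebin_coe_top (a : ℝ) : ebin a ⊤ = Ici a := by
  ext x
  simp [ebin]

lemma hasDerivAt_neg_exp_neg_mul (lam x : ℝ) :
    HasDerivAt (fun x ↦ -Real.exp (-lam * x)) (lam * Real.exp (-lam * x)) x := by
  have h := ((hasDerivAt_id x).const_mul (-lam)).exp.neg
  refine h.congr_deriv ?_
  simp only [id]
  ring

lemma hasDerivAt_neg_add_inv_mul_exp (hlam : 0 < lam) (x : ℝ) :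
    HasDerivAt (fun x ↦ -((x + 1 / lam) * Real.exp (-lam * x)))
      (x * (lam * Real.exp (-lam * x))) x := by
  have h := (((hasDerivAt_id x).add_const (1 / lam)).mul
    ((hasDerivAt_id x).const_mul (-lam)).exp).neg
  refine h.congr_deriv ?_
  simp only [id]
  field_simp
  ring

lemma condMean_expPDF_Ico (hlam : 0 < lam) (ha : 0 ≤ a) (hac : a < c) :
    condMean (expPDF lam) (Ico a c) = a + 1 / lam - centroidGap lam (c - a) := by
  have h0 : ∀ x ∈ Ico a c, expPDF lam x = lam * Real.exp (-lam * x) := fun x hx ↦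
    if_pos (ha.trans hx.1)
  have hden : ∫ x in Ico a c, expPDF lam x = Real.exp (-lam * a) - Real.exp (-lam * c) := by
    rw [setIntegral_congr_fun measurableSet_Ico h0, integral_Ico_eq_integral_Ioc,
      ← intervalIntegral.integral_of_le hac.le,
      intervalIntegral.integral_eq_sub_of_hasDerivAt
        (fun x _ ↦ hasDerivAt_neg_exp_neg_mul lam x)
        (Continuous.intervalIntegrable (by fun_prop) _ _)]
    ring
  have hnum : ∫ x in Ico a c, x * expPDF lam x =
      (a + 1 / lam) * Real.exp (-lam * a) - (c + 1 / lam) * Real.exp (-lam * c) := by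
    rw [setIntegral_congr_fun (g := fun x ↦ x * (lam * Real.exp (-lam * x)))
        measurableSet_Ico (fun x hx ↦ by simp only [h0 x hx]),
      integral_Ico_eq_integral_Ioc, ← intervalIntegral.integral_of_le hac.le,
      intervalIntegral.integral_eq_sub_of_hasDerivAt
        (fun x _ ↦ hasDerivAt_neg_add_inv_mul_exp hlam x)
        (Continuous.intervalIntegrable (by fun_prop) _ _)]
    ring
  have hpos := exp_mul_sub_one_pos hlam (sub_pos.2 hac)
  have hexp : Real.exp (-lam * a) = Real.exp (-lam * c) * Real.exp (lam * (c - a)) := by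
    rw [← Real.exp_add]
    ring_nf
  rw [condMean, hden, hnum, hexp, centroidGap]
  have hE := Real.exp_pos (-lam * c)
  set E := Real.exp (-lam * c)
  set F := Real.exp (lam * (c - a))
  have hEF : E * F - E = E * (F - 1) := by ring
  rw [hEF]
  field_simp
  ring

lemma condMean_expPDF_Ici (hlam : 0 < lam) (ha : 0 ≤ a) :
    condMean (expPDF lam) (Ici a) = a + 1 / lam := by
  have h0 : ∀ x ∈ Ici a, expPDF lam x = lam * Real.exp (-lam * x) := fun x hx ↦
    if_pos (ha.trans hx)
  have htop : Tendsto (fun x : ℝ ↦ lam * x) atTop atTop := tendsto_id.const_mul_atTop hlam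
  have hexp : Tendsto (fun x : ℝ ↦ Real.exp (-lam * x)) atTop (nhds 0) := by
    simpa [Function.comp_def] using Real.tendsto_exp_neg_atTop_nhds_zero.comp htop
  have hxexp : Tendsto (fun x : ℝ ↦ x * Real.exp (-lam * x)) atTop (nhds 0) := by
    have h := ((Real.tendsto_pow_mul_exp_neg_atTop_nhds_zero 1).comp htop).const_mul (1 / lam)
    rw [mul_zero] at h
    refine h.congr fun x ↦ ?_
    simp only [Function.comp_apply, pow_one, neg_mul]
    field_simp
  have hden : ∫ x in Ici a, expPDF lam x = Real.exp (-lam * a) := by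
    rw [setIntegral_congr_fun measurableSet_Ici h0, integral_Ici_eq_integral_Ioi,
      integral_Ioi_of_hasDerivAt_of_nonneg' (l := 0)
        (fun x _ ↦ hasDerivAt_neg_exp_neg_mul lam x) (fun x _ ↦ by positivity)
        (by simpa using hexp.neg)]
    ring
  have hnum : ∫ x in Ici a, x * expPDF lam x = (a + 1 / lam) * Real.exp (-lam * a) := by
    rw [setIntegral_congr_fun (g := fun x ↦ x * (lam * Real.exp (-lam * x)))
        measurableSet_Ici (fun x hx ↦ by simp only [h0 x hx]),
      integral_Ici_eq_integral_Ioi,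
      integral_Ioi_of_hasDerivAt_of_nonneg' (l := 0)
        (fun x _ ↦ hasDerivAt_neg_add_inv_mul_exp hlam x)
        (fun x hx ↦ by have : 0 < x := ha.trans_lt hx
                       positivity)
        (by simpa [add_mul] using (hxexp.add (hexp.const_mul (1 / lam))).neg)]
    ring
  rw [condMean, hden, hnum, mul_div_cancel_right₀ _ (Real.exp_pos _).ne']

end integrals

lemma edgesL_zero_eq_redge {N : ℕ} (m : Fin (N - 1) → ℝ) {k : ℕ} (hk : k ≤ N - 1) :
    edgesL 0 N m k = (redge N m k : EReal) := by
  rcases Nat.eq_zero_or_pos k with rfl | h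
  · simp [edgesL, redge]
  · simp [edgesL, redge, h.ne', hk, Nat.one_le_iff_ne_zero]

lemma edgesL_eq_top {N : ℕ} (mL : ℝ) (m : Fin (N - 1) → ℝ) {k : ℕ} (h0 : k ≠ 0)
    (hk : N - 1 < k) : edgesL mL N m k = ⊤ := by
  simp [edgesL, h0, hk.not_ge]

/-- Positive sequences solving the backward recursion of the exponential equilibrium increase
by less than `1/λ` at each step. -/
lemma lt_and_lt_add_inv_of_centroidGap_rec {lam C : ℝ} (hlam : 0 < lam) {n : ℕ} {l : ℕ → ℝ}
    (hpos : ∀ k, 1 ≤ k → k ≤ n → 0 < l k)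
    (hrec : ∀ k, 1 ≤ k → k < n →
      l k + centroidGap lam (l k) = C - centroidGap lam (l (k + 1)))
    (hlast : l n + centroidGap lam (l n) = C) {k : ℕ} (hk : 1 ≤ k) (hkn : k < n) :
    l k < l (k + 1) ∧ l (k + 1) < l k + 1 / lam := by
  have hgap : ∀ k, 1 ≤ k → k ≤ n → 0 < centroidGap lam (l k) := fun k h1 h2 ↦
    centroidGap_pos hlam (hpos k h1 h2)
  have hmono : ∀ j k, 1 ≤ k → k + 1 + j = n → l k < l (k + 1) := by
    intro j
    induction j with
    | zero =>
      intro k h1 h2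
      obtain rfl : k + 1 = n := h2
      have := hgap (k + 1) (by omega) le_rfl
      refine ((add_centroidGap_strictMonoOn hlam).lt_iff_lt (hpos k h1 (by omega))
        (hpos (k + 1) (by omega) le_rfl)).1 ?_
      have := hrec k h1 (by omega)
      linarith
    | succ j ih =>
      intro k h1 h2
      have hlt := ih (k + 1) (by omega) (by omega)
      refine ((add_centroidGap_strictMonoOn hlam).lt_iff_lt (hpos k h1 (by omega))
        (hpos (k + 1) (by omega) (by omega))).1 ?_
      have := centroidGap_strictAntiOn hlam (hpos (k + 1) (by omega) (by omega))
        (hpos (k + 1 + 1) (by omega) (by omega)) hlt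
      have := hrec k h1 (by omega)
      have := hrec (k + 1) (by omega) (by omega)
      linarith
  refine ⟨hmono (n - (k + 1)) k hk (by omega), ?_⟩
  have hle : l (k + 1) + centroidGap lam (l (k + 1)) ≤ C := by
    rcases (Nat.succ_le_of_lt hkn).eq_or_lt with h | h
    · rw [← Nat.succ_eq_add_one, h, hlast]
    · have := hrec (k + 1) (by omega) h
      have := hgap (k + 1 + 1) (by omega) h
      linarith
  have := hrec k hk hkn
  have := centroidGap_lt_inv hlam (hpos k hk hkn.le)
  linarith

/-- For an exponential source with parameter `λ > 0` at an `N`-bin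
equilibrium (`N ≥ 3`) with bias `b`, the bin lengths `l_k = m_k − m_{k−1}` are strictly
increasing, `l_1 < l_2 < ⋯ < l_{N−1}`, and moreover `l_{k+1} < l_k + 1/λ` for
`k = 1, …, N−2`. -/
theorem exp_equilibrium_binLengths_increasing (lam b : ℝ) (hlam : 0 < lam)
    (N : ℕ) (hN : 3 ≤ N) (m : Fin (N - 1) → ℝ)
    (heq : IsEqL (expPDF lam) 0 b N m)
    (l : ℕ → ℝ) (hl : ∀ k, l k = redge N m k - redge N m (k - 1)) :
    ∀ k, 1 ≤ k → k ≤ N - 2 → l k < l (k + 1) ∧ l (k + 1) < l k + 1 / lam := by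
  obtain ⟨hmono, hm0, hcent⟩ := heq
  have hr : ∀ k, 1 ≤ k → (hk : k ≤ N - 1) → redge N m k = m ⟨k - 1, by omega⟩ :=
    fun k h1 hk ↦ dif_pos ⟨h1, hk⟩
  have hr0 : redge N m 0 = 0 := dif_neg (by omega)
  have hnonneg : ∀ k, k ≤ N - 1 → 0 ≤ redge N m k := by
    intro k hk
    rcases Nat.eq_zero_or_pos k with rfl | h
    · exact hr0.ge
    · rw [hr k h hk]
      exact (hm0 _).le
  have hlt : ∀ k, k + 1 ≤ N - 1 → redge N m k < redge N m (k + 1) := by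
    intro k hk
    rw [hr (k + 1) (by omega) hk]
    rcases Nat.eq_zero_or_pos k with rfl | h
    · rw [hr0]
      exact hm0 _
    · rw [hr k h (by omega)]
      exact hmono (Fin.mk_lt_mk.2 (by omega))
  have hl' : ∀ k, l (k + 1) = redge N m (k + 1) - redge N m k := fun k ↦ hl (k + 1)
  have hbin : ∀ k, k + 1 ≤ N - 1 →
      condMean (expPDF lam) (ebin (edgesL 0 N m k) (edgesL 0 N m (k + 1))) =
        redge N m k + 1 / lam - centroidGap lam (l (k + 1)) := by
    intro k hk
    rw [edgesL_zero_eq_redge m hk, edgesL_zero_eq_redge m (by omega), ebin_coe_coe,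
      condMean_expPDF_Ico hlam (hnonneg k (by omega)) (hlt k hk), hl']
  have hcent' : ∀ k, (hk : k + 1 ≤ N - 1) → redge N m (k + 1) =
      (redge N m k + 1 / lam - centroidGap lam (l (k + 1)) + condMean (expPDF lam)
        (ebin (edgesL 0 N m (k + 1)) (edgesL 0 N m (k + 2)))) / 2 + b := by
    intro k hk
    rw [← hbin k hk, hr (k + 1) (by omega) hk]
    exact hcent ⟨k, by omega⟩
  have h2 : 2 / lam = 1 / lam + 1 / lam := by ring
  intro k hk hkN
  refine lt_and_lt_add_inv_of_centroidGap_rec (C := 2 / lam + 2 * b) (n := N - 1) hlam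
    ?_ ?_ ?_ hk (by omega)
  · intro k h1 hk
    obtain ⟨k, rfl⟩ := Nat.exists_eq_add_of_le' h1
    rw [hl']
    exact sub_pos.2 (hlt k hk)
  · intro k h1 hk
    obtain ⟨k, rfl⟩ := Nat.exists_eq_add_of_le' h1
    have h := hcent' k hk.le
    rw [hbin (k + 1) hk] at h
    linarith [hl' k, h2]
  · obtain ⟨k, hkn⟩ : ∃ k, N - 1 = k + 1 := ⟨N - 2, by omega⟩
    have h := hcent' k hkn.ge
    rw [edgesL_zero_eq_redge m hkn.ge, edgesL_eq_top 0 m (by omega) (by omega), ebin_coe_top,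
      condMean_expPDF_Ici hlam (hnonneg _ hkn.ge)] at h
    rw [hkn]
    linarith [hl' k, h2]
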